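/- arXiv:1406.4011 — 2 statements merged into one kernel-verified Lean document; each statement's English description precedes it below -/
import Mathlib

section
/- Let γ_D be exponentially distributed with mean γ̄_D and γ_I a nonnegative random variable, independent, with density f_{γ_I} given by f(x) = 2 (k/γ̄_I)^((L+k)/2) x^((L+k)/2 - 1) K_{L-k}(2√(k x/γ̄_I)) / (Γ(L) Γ(k)). Then the CDF of γ_out = γ_D/(1+γ_I) is F(γ) = 1 - exp(-γ/γ̄_D) (k γ̄_D/(γ̄_I γ))^((L+k-1)/2) exp(k γ̄_D/(2 γ̄_I γ)) W_{(1-L-k)/2, (L-k)/2}(k γ̄_D/(γ̄_I γ)) for γ > 0, where W_{λ,μ} is the Whittaker W function. -/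
open MeasureTheory Set ProbabilityTheory

/-- Modified Bessel function of the second kind, via its integral representation. -/
noncomputable def besselK (ν x : ℝ) : ℝ :=
  ∫ t in Ioi (0:ℝ), Real.exp (-x * Real.cosh t) * Real.cosh (ν * t)

/-- The density of the sum of `L` fully correlated squared-K interferers with shape `k`
and mean parameter `γ̄_I`. -/
noncomputable def fcDensity (L k γbar x : ℝ) : ℝ :=
  2 * (k / γbar) ^ ((L + k) / 2) * x ^ ((L + k) / 2 - 1) / (Real.Gamma L * Real.Gamma k) *
    besselK (L - k) (2 * Real.sqrt (k * x / γbar))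

/-- The Whittaker `W` function, via its integral representation
`W_{λ,μ}(z) = e^{-z/2} z^λ / Γ(μ-λ+1/2) ∫₀^∞ e^{-t} t^{μ-λ-1/2} (1+t/z)^{μ+λ-1/2} dt`. -/
noncomputable def whittakerW (lam mu z : ℝ) : ℝ :=
  Real.exp (-z / 2) * z ^ lam / Real.Gamma (mu - lam + 1/2) *
    ∫ t in Ioi (0:ℝ), Real.exp (-t) * t ^ (mu - lam - 1/2) * (1 + t / z) ^ (mu + lam - 1/2)

lemma besselK_integrable (ν y : ℝ) (hy : 0 < y) :
    IntegrableOn (fun t => Real.exp (-y * Real.cosh t) * Real.cosh (ν * t)) (Ioi (0:ℝ)) := by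
  have h1 : IntegrableOn (fun t : ℝ => Real.exp ((|ν| + 1)^2 / y) * Real.exp (-1 * t)) (Ioi 0) :=
    (exp_neg_integrableOn_Ioi 0 one_pos).const_mul _
  refine Integrable.mono' h1 (by
    apply Continuous.aestronglyMeasurable
    have := Real.continuous_cosh
    fun_prop) ?_
  filter_upwards [ae_restrict_mem measurableSet_Ioi] with t ht
  have ht0 : 0 < t := ht
  rw [Real.norm_of_nonneg (mul_nonneg (Real.exp_pos _).le (Real.cosh_pos _).le)]
  have hc : Real.cosh (ν * t) ≤ Real.exp (|ν| * t) := by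
    rw [← Real.cosh_abs, abs_mul, abs_of_pos ht0, Real.cosh_eq]
    have : Real.exp (-(|ν| * t)) ≤ Real.exp (|ν| * t) := by
      apply Real.exp_le_exp.2
      have : 0 ≤ |ν| * t := by positivity
      linarith
    linarith
  have hq : t ^ 2 / 4 ≤ Real.cosh t := by
    rw [Real.cosh_eq]
    have := Real.quadratic_le_exp_of_nonneg ht0.le
    have := Real.exp_pos (-t)
    linarith
  have hy2 : (|ν| + 1) * t ≤ y * (t^2/4) + (|ν|+1)^2 / y := by
    have : y * (t^2/4) + (|ν|+1)^2 / y - (|ν| + 1) * t = (y * t / 2 - (|ν|+1))^2 / y := by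
      field_simp; ring
    have : 0 ≤ (y * t / 2 - (|ν|+1))^2 / y := by positivity
    linarith
  have hy3 : y * (t^2/4) ≤ y * Real.cosh t := by gcongr
  calc _ ≤ Real.exp (-y * Real.cosh t) * Real.exp (|ν| * t) := by gcongr
    _ = Real.exp (-y * Real.cosh t + |ν| * t) := by rw [Real.exp_add]
    _ ≤ Real.exp ((|ν| + 1)^2 / y + -1 * t) := by
      apply Real.exp_le_exp.2; linarith
    _ = _ := by rw [Real.exp_add]

lemma besselK_lint (ν y : ℝ) (hy : 0 < y) :
    ENNReal.ofReal (besselK ν y) =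
      ∫⁻ t, ENNReal.ofReal (Real.exp (-y * Real.cosh t) * Real.exp (ν * t) / 2) := by
  have hcc := Real.continuous_cosh
  have hmeas : Measurable (fun t => ENNReal.ofReal (Real.exp (-y * Real.cosh t) * Real.exp (ν * t) / 2)) := by
    have : Measurable Real.cosh := hcc.measurable
    fun_prop
  unfold besselK
  rw [ofReal_integral_eq_lintegral_ofReal (besselK_integrable ν y hy)
    (Filter.Eventually.of_forall fun t => mul_nonneg (Real.exp_pos _).le (Real.cosh_pos _).le)]
  rw [← lintegral_add_compl (fun t => ENNReal.ofReal (Real.exp (-y * Real.cosh t) * Real.exp (ν * t) / 2))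
    (measurableSet_Ioi (a := (0:ℝ))), compl_Ioi,
    setLIntegral_congr (Iio_ae_eq_Iic (a := (0:ℝ)) (μ := volume)).symm]
  have h2 := (Measure.measurePreserving_neg (volume : Measure ℝ)).setLIntegral_comp_preimage
    (measurableSet_Iio (a := (0:ℝ))) hmeas
  have h3 : (Neg.neg ⁻¹' Iio (0:ℝ)) = Ioi 0 := by ext x; simp
  rw [h3] at h2
  rw [← h2, ← lintegral_add_left hmeas]
  apply lintegral_congr
  intro t
  rw [← ENNReal.ofReal_add (by positivity) (by positivity)]
  congr 1
  rw [Real.cosh_neg, Real.cosh_eq (ν * t), mul_neg]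
  ring

lemma exp_subst (c : ℝ) (hc : 0 < c) (h : ℝ → ENNReal) :
    ∫⁻ u in Ioi (0:ℝ), h u = ∫⁻ t, ENNReal.ofReal (c * Real.exp t) * h (c * Real.exp t) := by
  have him : (fun t => c * Real.exp t) '' univ = Ioi 0 := by
    ext u
    simp only [image_univ, mem_range, mem_Ioi]
    constructor
    · rintro ⟨t, rfl⟩; positivity
    · intro hu
      exact ⟨Real.log (u / c), by rw [Real.exp_log (by positivity)]; field_simp⟩
  have := lintegral_image_eq_lintegral_abs_deriv_mul (f := fun t => c * Real.exp t)
    (f' := fun t => c * Real.exp t) MeasurableSet.univ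
    (fun t _ => ((Real.hasDerivAt_exp t).const_mul c).hasDerivWithinAt)
    (by
      intro a _ b _ hab
      have : c * Real.exp a = c * Real.exp b := hab
      exact Real.exp_injective (mul_left_cancel₀ hc.ne' this)) h
  rw [him] at this
  rw [this, Measure.restrict_univ]
  apply lintegral_congr
  intro t
  rw [abs_of_pos (by positivity)]

lemma fc_lint (L k g x : ℝ) (hL : 0 < L) (hk : 0 < k) (hg : 0 < g) (hx : 0 < x) :
    ENNReal.ofReal (fcDensity L k g x) = ∫⁻ u in Ioi (0:ℝ), ENNReal.ofReal
      ((k/g)^k * x^(k-1) * u^(L-k-1) * Real.exp (-u - k/g*x/u) / (Real.Gamma L * Real.Gamma k)) := by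
  have hGL := Real.Gamma_pos_of_pos hL
  have hGk := Real.Gamma_pos_of_pos hk
  have ha : 0 < k / g := by positivity
  unfold fcDensity
  have e : k * x / g = k / g * x := by ring
  rw [e]
  generalize k / g = a at *
  have hax : 0 < a * x := by positivity
  have hs : 0 < Real.sqrt (a * x) := Real.sqrt_pos.2 hax
  rw [ENNReal.ofReal_mul (by positivity), besselK_lint _ _ (by positivity),
    ← lintegral_const_mul' _ _ ENNReal.ofReal_ne_top, exp_subst _ hs]
  apply lintegral_congr
  intro t
  rw [← ENNReal.ofReal_mul (by positivity), ← ENNReal.ofReal_mul (by positivity)]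
  congr 1
  have h1 : Real.exp (-(Real.sqrt (a*x) * Real.exp t) - a * x / (Real.sqrt (a*x) * Real.exp t))
      = Real.exp (-(2 * Real.sqrt (a*x)) * Real.cosh t) := by
    congr 1
    rw [Real.cosh_eq, Real.exp_neg]
    have h := Real.mul_self_sqrt hax.le
    have : a * x / (Real.sqrt (a*x) * Real.exp t) = Real.sqrt (a*x) / Real.exp t := by
      rw [div_eq_div_iff (by positivity) (by positivity)]
      linear_combination (-Real.exp t) * h
    rw [this]
    field_simp
    ring
  rw [h1]
  have h2 : Real.sqrt (a*x) * Real.exp t * (Real.sqrt (a*x) * Real.exp t)^(L-k-1)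
     = a^((L-k)/2) * x^((L-k)/2) * Real.exp ((L-k)*t) := by
    have hp : 0 < Real.sqrt (a*x) * Real.exp t := by positivity
    calc _ = (Real.sqrt (a*x) * Real.exp t)^(1:ℝ) * (Real.sqrt (a*x) * Real.exp t)^(L-k-1) := by
            rw [Real.rpow_one]
      _ = (Real.sqrt (a*x) * Real.exp t)^(L-k) := by rw [← Real.rpow_add hp]; congr 1; ring
      _ = _ := by
        rw [Real.mul_rpow hs.le (Real.exp_pos t).le, ← Real.exp_mul, Real.sqrt_eq_rpow,
          ← Real.rpow_mul hax.le, Real.mul_rpow ha.le hx.le]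
        ring_nf
  have h3 : a^((L+k)/2) = a^k * a^((L-k)/2) := by rw [← Real.rpow_add ha]; congr 1; ring
  have h4 : x^((L+k)/2-1) = x^(k-1) * x^((L-k)/2) := by rw [← Real.rpow_add hx]; congr 1; ring
  rw [h3, h4]
  have h5 : ∀ A B C D E F G : ℝ, A * B * (C * D * E * F / G) = C * D * (A * B * E) * F / G := by
    intros; ring
  rw [h5, h2]
  ring

lemma gamma_lint (k r : ℝ) (hk : 0 < k) (hr : 0 < r) :
    ∫⁻ x in Ioi (0:ℝ), ENNReal.ofReal (x^(k-1) * Real.exp (-(r*x))) =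
      ENNReal.ofReal ((1/r)^k * Real.Gamma k) := by
  have h := Real.integral_rpow_mul_exp_neg_mul_Ioi hk hr
  rw [← h, ofReal_integral_eq_lintegral_ofReal]
  · by_contra hn
    rw [integral_undef hn] at h
    have := Real.Gamma_pos_of_pos hk
    have : 0 < (1/r)^k * Real.Gamma k := by positivity
    linarith
  · filter_upwards [ae_restrict_mem measurableSet_Ioi] with x hx
    have : 0 < x := hx
    positivity

lemma laplace (L k g s : ℝ) (hL : 0 < L) (hk : 0 < k) (hg : 0 < g) (hs : 0 < s) :
    ∫⁻ x in Ioi (0:ℝ), ENNReal.ofReal (Real.exp (-(s*(1+x)))) * ENNReal.ofReal (fcDensity L k g x) =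
    ENNReal.ofReal (Real.exp (-s) / Real.Gamma L) * ∫⁻ u in Ioi (0:ℝ), ENNReal.ofReal
      (Real.exp (-u) * u^(L-1) * (1 + u/(k/g/s))^(-k)) := by
  have hGL := Real.Gamma_pos_of_pos hL
  have hGk := Real.Gamma_pos_of_pos hk
  have ha : 0 < k / g := by positivity
  have e1 : ∀ x ∈ Ioi (0:ℝ), ENNReal.ofReal (Real.exp (-(s*(1+x)))) * ENNReal.ofReal (fcDensity L k g x)
      = ∫⁻ u in Ioi (0:ℝ), ENNReal.ofReal (Real.exp (-(s*(1+x)))) * ENNReal.ofReal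
      ((k/g)^k * x^(k-1) * u^(L-k-1) * Real.exp (-u - k/g*x/u) / (Real.Gamma L * Real.Gamma k)) := by
    intro x hx
    rw [fc_lint L k g x hL hk hg hx, lintegral_const_mul' _ _ ENNReal.ofReal_ne_top]
  rw [setLIntegral_congr_fun measurableSet_Ioi e1, lintegral_lintegral_swap (by
    apply Measurable.aemeasurable
    unfold Function.uncurry
    fun_prop), ← lintegral_const_mul' _ _ ENNReal.ofReal_ne_top]
  apply setLIntegral_congr_fun measurableSet_Ioi
  intro u hu
  have hu : 0 < u := hu
  generalize k / g = a at *
  dsimp only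
  have e2 : ∀ x ∈ Ioi (0:ℝ), ENNReal.ofReal (Real.exp (-(s*(1+x)))) * ENNReal.ofReal
      (a^k * x^(k-1) * u^(L-k-1) * Real.exp (-u - a*x/u) / (Real.Gamma L * Real.Gamma k)) =
      ENNReal.ofReal (Real.exp (-s) * a^k * u^(L-k-1) * Real.exp (-u) / (Real.Gamma L * Real.Gamma k)) *
      ENNReal.ofReal (x^(k-1) * Real.exp (-((s + a/u)*x))) := by
    intro x hx
    have hx : 0 < x := hx
    rw [← ENNReal.ofReal_mul (by positivity), ← ENNReal.ofReal_mul (by positivity)]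
    congr 1
    have h1 : Real.exp (-(s*(1+x))) = Real.exp (-s) * Real.exp (-(s*x)) := by
      rw [← Real.exp_add]; congr 1; ring
    have h2 : Real.exp (-u - a*x/u) = Real.exp (-u) * Real.exp (-(a*x/u)) := by
      rw [← Real.exp_add]; congr 1
    have h3 : Real.exp (-((s + a/u)*x)) = Real.exp (-(s*x)) * Real.exp (-(a*x/u)) := by
      rw [← Real.exp_add]; congr 1; ring
    rw [h1, h2, h3]; ring
  rw [setLIntegral_congr_fun measurableSet_Ioi e2, lintegral_const_mul' _ _ ENNReal.ofReal_ne_top,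
    gamma_lint k _ hk (by positivity), ← ENNReal.ofReal_mul (by positivity),
    ← ENNReal.ofReal_mul (by positivity)]
  congr 1
  have h4 : u^(L-1) = u^(L-k-1) * u^k := by rw [← Real.rpow_add hu]; congr 1; ring
  have h5 : a^k * (1/(s+a/u))^k = u^k * (1 + u/(a/s))^(-k) := by
    rw [← Real.mul_rpow ha.le (by positivity), Real.rpow_neg (by positivity),
      ← Real.inv_rpow (by positivity), ← Real.mul_rpow hu.le (by positivity)]
    congr 1
    field_simp
    ring
  rw [h4]
  have h6 : ∀ A B C D E F G K : ℝ, G ≠ 0 → A * B * C * D / (E * G) * (K * G) = A * C * D / E * (B * K) := by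
    intros; field_simp
  rw [h6 _ _ _ _ _ 0 _ _ hGk.ne', h5]
  ring


lemma fc_measurable (L k g : ℝ) (hL : 0 < L) (hk : 0 < k) (hg : 0 < g) :
    Measurable (fun x => ENNReal.ofReal (if 0 < x then fcDensity L k g x else 0)) := by
  have : (fun x => ENNReal.ofReal (if 0 < x then fcDensity L k g x else 0)) =
      fun x => if 0 < x then ∫⁻ u in Ioi (0:ℝ), ENNReal.ofReal
      ((k/g)^k * x^(k-1) * u^(L-k-1) * Real.exp (-u - k/g*x/u) / (Real.Gamma L * Real.Gamma k))
      else 0 := by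
    funext x
    split_ifs with hx
    · exact fc_lint L k g x hL hk hg hx
    · simp
  rw [this]
  refine Measurable.ite measurableSet_Ioi ?_ measurable_const
  apply Measurable.lintegral_prod_right'
    (f := fun p : ℝ × ℝ => ENNReal.ofReal
      ((k/g)^k * p.1^(k-1) * p.2^(L-k-1) * Real.exp (-p.2 - k/g*p.1/p.2) / (Real.Gamma L * Real.Gamma k)))
  fun_prop

lemma exp_tail (r : ℝ) (hr : 0 < r) (c : ℝ) (hc : 0 ≤ c) (μ : Measure ℝ) [IsProbabilityMeasure μ]
    (hμ : μ = volume.withDensity (exponentialPDF r)) :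
    μ (Ioi c) = ENNReal.ofReal (Real.exp (-(r * c))) := by
  have h1 : μ (Iic c) = ENNReal.ofReal (1 - Real.exp (-(r*c))) := by
    rw [hμ, withDensity_apply _ measurableSet_Iic, lintegral_exponentialPDF_eq_antiDeriv hr, if_pos hc]
  have : Real.exp (-(r*c)) ≤ 1 := Real.exp_le_one_iff.2 (by have := mul_nonneg hr.le hc; linarith)
  rw [← compl_Iic, prob_compl_eq_one_sub measurableSet_Iic, h1, ← ENNReal.ofReal_one,
    ← ENNReal.ofReal_sub _ (by linarith)]
  congr 1; ring

/-- CDF of the SINR `γ_out = γ_D/(1+γ_I)` with `γ_D` exponential (mean `γ̄_D`) and `γ_I`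
fully-correlated-shadowing distributed, independent. -/
theorem sinr_cdf_fully_correlated
    {Ω : Type*} [MeasureSpace Ω] [IsProbabilityMeasure (ℙ : Measure Ω)]
    (γD γI : Ω → ℝ) (hmD : Measurable γD) (hmI : Measurable γI)
    (γbarD γbarI L k : ℝ) (hD0 : 0 < γbarD) (hI0 : 0 < γbarI) (hL : 0 < L) (hk : 0 < k)
    (hindep : IndepFun γD γI)
    (hD : Measure.map γD ℙ = volume.withDensity (exponentialPDF (1/γbarD)))
    (hI : Measure.map γI ℙ =
      volume.withDensity (fun x => ENNReal.ofReal (if 0 < x then fcDensity L k γbarI x else 0))) :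
    ∀ γ : ℝ, 0 < γ →
      (ℙ {ω | γD ω / (1 + γI ω) ≤ γ}).toReal =
        1 - Real.exp (-γ / γbarD) * (k * γbarD / (γbarI * γ)) ^ ((L + k - 1) / 2) *
          Real.exp (k * γbarD / (2 * γbarI * γ)) *
          whittakerW ((1 - L - k) / 2) ((L - k) / 2) (k * γbarD / (γbarI * γ)) := by
  intro γ hγ
  have := Measure.isProbabilityMeasure_map (μ := (ℙ : Measure Ω)) hmD.aemeasurable
  have := Measure.isProbabilityMeasure_map (μ := (ℙ : Measure Ω)) hmI.aemeasurable
  have hdm := fc_measurable L k γbarI hL hk hI0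
  have hGL := Real.Gamma_pos_of_pos hL
  have hae : ∀ᵐ ω ∂(ℙ : Measure Ω), 0 < γI ω := by
    have : ∀ᵐ x ∂(Measure.map γI ℙ), 0 < x := by
      rw [hI, ae_withDensity_iff hdm]
      refine Filter.Eventually.of_forall fun x hx => ?_
      by_contra h
      simp [h] at hx
    exact ae_of_ae_map hmI.aemeasurable this
  have hms : MeasurableSet {ω | γD ω / (1 + γI ω) ≤ γ} :=
    measurableSet_le (by fun_prop) measurable_const
  have hmS : MeasurableSet {p : ℝ × ℝ | γ * (1 + p.2) < p.1} :=
    measurableSet_lt (by fun_prop) (by fun_prop)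
  have hcompl : (ℙ : Measure Ω) {ω | γD ω / (1 + γI ω) ≤ γ}ᶜ =
      Measure.map (fun ω => (γD ω, γI ω)) ℙ {p : ℝ × ℝ | γ * (1 + p.2) < p.1} := by
    rw [Measure.map_apply (hmD.prodMk hmI) hmS]
    apply measure_congr
    filter_upwards [hae] with ω hω
    apply propext
    change ¬ (γD ω / (1 + γI ω) ≤ γ) ↔ γ * (1 + γI ω) < γD ω
    rw [not_le, lt_div_iff₀ (by linarith)]
  have hs : 0 < γ / γbarD := by positivity
  have hval : (ℙ : Measure Ω) {ω | γD ω / (1 + γI ω) ≤ γ}ᶜ =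
      ENNReal.ofReal (Real.exp (-(γ / γbarD)) / Real.Gamma L) * ∫⁻ u in Ioi (0:ℝ), ENNReal.ofReal
      (Real.exp (-u) * u^(L-1) * (1 + u/(k/γbarI/(γ / γbarD)))^(-k)) := by
    rw [hcompl, (indepFun_iff_map_prod_eq_prod_map_map hmD.aemeasurable hmI.aemeasurable).1 hindep,
      Measure.prod_apply_symm hmS, ← laplace L k γbarI _ hL hk hI0 hs]
    have hmF := measurable_measure_prodMk_right (μ := Measure.map γD ℙ) hmS
    nth_rewrite 1 [hI]
    rw [lintegral_withDensity_eq_lintegral_mul _ hdm hmF,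
      ← lintegral_indicator measurableSet_Ioi]
    apply lintegral_congr
    intro x
    by_cases hx : 0 < x
    · have e : (fun y => (y, x)) ⁻¹' {p : ℝ × ℝ | γ * (1 + p.2) < p.1} = Ioi (γ * (1 + x)) := rfl
      simp only [Pi.mul_apply, indicator, mem_Ioi, hx, if_true]
      rw [e, exp_tail (1/γbarD) (by positivity) _ (by positivity) _ hD, mul_comm]
      congr 4
      ring
    · simp [hx]
  have h1 : (ℙ {ω | γD ω / (1 + γI ω) ≤ γ}).toReal =
      1 - ((ℙ : Measure Ω) {ω | γD ω / (1 + γI ω) ≤ γ}ᶜ).toReal := by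
    have := probReal_compl_eq_one_sub (μ := (ℙ : Measure Ω)) hms
    simp only [measureReal_def] at this
    rw [this]; ring
  rw [h1, hval, ENNReal.toReal_mul, ENNReal.toReal_ofReal (by positivity)]
  have hz : k/γbarI/(γ / γbarD) = k * γbarD / (γbarI * γ) := by field_simp
  have hz2 : k * γbarD / (2 * γbarI * γ) = k * γbarD / (γbarI * γ) / 2 := by field_simp
  have hz0 : 0 < k * γbarD / (γbarI * γ) := by positivity
  rw [hz, hz2]
  generalize k * γbarD / (γbarI * γ) = z at *
  rw [← integral_eq_lintegral_of_nonneg_ae]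
  · unfold whittakerW
    have a1 : (L - k) / 2 - (1 - L - k) / 2 + 1 / 2 = L := by ring
    have a2 : (L - k) / 2 - (1 - L - k) / 2 - 1 / 2 = L - 1 := by ring
    have a3 : (L - k) / 2 + (1 - L - k) / 2 - 1 / 2 = -k := by ring
    rw [a1, a2, a3]
    have b1 : z ^ ((L + k - 1) / 2) * z ^ ((1 - L - k) / 2) = 1 := by
      rw [← Real.rpow_add hz0]
      have : (L + k - 1) / 2 + (1 - L - k) / 2 = 0 := by ring
      rw [this, Real.rpow_zero]
    have b2 : Real.exp (z / 2) * Real.exp (-z / 2) = 1 := by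
      rw [← Real.exp_add]
      have : z / 2 + -z / 2 = 0 := by ring
      rw [this, Real.exp_zero]
    have b3 : ∀ A B C D E G I : ℝ, B * E = 1 → C * D = 1 →
        A / G * I = A * B * C * (D * E / G * I) := by
      intro A B C D E G I h h'
      have : A * B * C * (D * E / G * I) = (B * E) * (C * D) * (A / G * I) := by ring
      rw [this, h, h']; ring
    rw [← b3 _ _ _ _ _ _ _ b1 b2, neg_div]
  · filter_upwards [ae_restrict_mem measurableSet_Ioi] with u hu
    have : 0 < u := hu
    positivity
  · apply Measurable.aestronglyMeasurable
    fun_prop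
end

section
/- Diversity order of the SINR-based selection scheme: with F_out the single-branch SINR CDF F_out(γ) = 1 − e^{−γ/γ̄_D}(kγ̄_D/(γ̄_Iγ))^((L+k−1)/2) e^{kγ̄_D/(2γ̄_Iγ)} W_{(1−L−k)/2,(L−k)/2}(kγ̄_D/(γ̄_Iγ)), the N-branch outage F_out(γ)^N satisfies lim_{γ̄_D→∞} γ̄_D^N · F_out(γ)^N = (E[(1+γ_I)])^N γ^N = (1 + E[γ_I])^N γ^N, i.e., the diversity gain equals N. -/
open MeasureTheory Set Filter

noncomputable def hker (L k c x u : ℝ) : ℝ :=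
  (u ^ (L - k - 1) * Real.exp (-u)) * (c ^ k * (x ^ (k - 1) * Real.exp (-((c / u) * x))))

lemma hker_meas (L k c : ℝ) : Measurable (Function.uncurry (hker L k c)) := by
  unfold hker Function.uncurry
  fun_prop

lemma hker_nonneg {L k c x u : ℝ} (hc : 0 < c) (hx : 0 < x) (hu : 0 < u) :
    0 ≤ hker L k c x u := by
  unfold hker; positivity

lemma hker_int_x {L k c u : ℝ} (hk : 0 < k) (hc : 0 < c) (hu : 0 < u) :
    IntegrableOn (fun x => hker L k c x u) (Ioi 0) := by
  unfold hker
  refine Integrable.const_mul (Integrable.const_mul ?_ _) _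
  have := integrableOn_rpow_mul_exp_neg_mul_rpow (p := 1) (s := k - 1) (b := c / u)
    (by linarith) one_pos (by positivity)
  simpa [IntegrableOn] using this

lemma hker_integral_x {L k c u : ℝ} (hk : 0 < k) (hc : 0 < c) (hu : 0 < u) :
    ∫ x in Ioi (0:ℝ), hker L k c x u = Real.Gamma k * (Real.exp (-u) * u ^ (L - 1)) := by
  unfold hker
  rw [integral_const_mul, integral_const_mul,
    Real.integral_rpow_mul_exp_neg_mul_Ioi hk (by positivity), one_div_div,
    Real.div_rpow hu.le hc.le]
  have h1 : u ^ (L - 1) = u ^ (L - k - 1) * u ^ k := by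
    rw [← Real.rpow_add hu]; ring_nf
  have : c ^ k ≠ 0 := by positivity
  rw [h1]; field_simp

lemma hker_prod {L k c : ℝ} (hL : 0 < L) (hk : 0 < k) (hc : 0 < c) :
    Integrable (Function.uncurry (hker L k c))
      ((volume.restrict (Ioi 0)).prod (volume.restrict (Ioi 0))) := by
  rw [integrable_prod_iff' (hker_meas L k c).aestronglyMeasurable]
  constructor
  · filter_upwards [ae_restrict_mem measurableSet_Ioi] with u hu
    exact hker_int_x hk hc hu
  · have := (Real.GammaIntegral_convergent hL).const_mul (Real.Gamma k)
    refine Integrable.congr this ?_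
    filter_upwards [ae_restrict_mem measurableSet_Ioi] with u hu
    rw [← hker_integral_x hk hc hu]
    refine setIntegral_congr_fun measurableSet_Ioi fun x hx => ?_
    simp only [Function.uncurry]
    rw [Real.norm_of_nonneg (hker_nonneg hc hx hu)]

lemma hker_total {L k c : ℝ} (hL : 0 < L) (hk : 0 < k) (hc : 0 < c) :
    ∫ x in Ioi (0:ℝ), ∫ u in Ioi (0:ℝ), hker L k c x u = Real.Gamma L * Real.Gamma k := by
  rw [integral_integral_swap (hker_prod hL hk hc),
    setIntegral_congr_fun measurableSet_Ioi (fun u hu => hker_integral_x hk hc hu),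
    integral_const_mul, ← Real.Gamma_eq_integral hL, mul_comm]

lemma hker_bessel {L k c x : ℝ} (hc : 0 < c) (hx : 0 < x)
    (hi : IntegrableOn (fun u => hker L k c x u) (Ioi 0)) :
    2 * c ^ ((L + k) / 2) * x ^ ((L + k) / 2 - 1) * besselK (L - k) (2 * Real.sqrt (c * x)) =
      ∫ u in Ioi (0:ℝ), hker L k c x u := by
  obtain ⟨a, rfl⟩ : ∃ a, a = Real.sqrt (c * x) := ⟨_, rfl⟩
  set a := Real.sqrt (c * x) with ha
  have ha0 : 0 < a := Real.sqrt_pos.2 (by positivity)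
  have haa : a * a = c * x := Real.mul_self_sqrt (by positivity)
  set C := c ^ ((L + k) / 2) * x ^ ((L + k) / 2 - 1) with hC
  have hCC : a ^ (L - k) * (c ^ k * x ^ (k - 1)) = C := by
    have : a = (c * x) ^ ((1:ℝ) / 2) := Real.sqrt_eq_rpow _
    rw [this, ← Real.rpow_mul (by positivity), Real.mul_rpow hc.le hx.le, hC,
      show (L + k) / 2 - 1 = 1 / 2 * (L - k) + (k - 1) by ring,
      show (L + k) / 2 = 1 / 2 * (L - k) + k by ring, Real.rpow_add hc, Real.rpow_add hx]
    ring
  have him : (fun t => a * Real.exp t) '' univ = Ioi 0 := by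
    ext y
    simp only [image_univ, mem_range, mem_Ioi]
    constructor
    · rintro ⟨t, rfl⟩; positivity
    · intro hy
      refine ⟨Real.log (y / a), ?_⟩
      rw [Real.exp_log (by positivity)]; field_simp
  have hder : ∀ t ∈ (univ : Set ℝ),
      HasDerivWithinAt (fun t => a * Real.exp t) (a * Real.exp t) univ t := fun t _ =>
    ((Real.hasDerivAt_exp t).const_mul a).hasDerivWithinAt
  have hinj : InjOn (fun t => a * Real.exp t) univ := by
    intro s _ t _ h
    exact Real.exp_injective (mul_left_cancel₀ ha0.ne' h)
  set F : ℝ → ℝ := fun t => C * (Real.exp (-(2 * a) * Real.cosh t) * Real.exp ((L - k) * t)) with hF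
  have hFe : ∀ t, |a * Real.exp t| • hker L k c x (a * Real.exp t) = F t := by
    intro t
    have hp : 0 < a * Real.exp t := by positivity
    rw [abs_of_pos hp, smul_eq_mul, hker, ← mul_assoc (a * Real.exp t), ← mul_assoc (a * Real.exp t),
      Real.rpow_sub_one hp.ne',
      mul_div_cancel₀ _ hp.ne', Real.mul_rpow ha0.le (Real.exp_pos t).le, ← Real.exp_mul, hF]
    have e1 : c / (a * Real.exp t) * x = a * Real.exp (-t) := by
      rw [Real.exp_neg]
      have := Real.exp_pos t
      field_simp
      nlinarith
    have e2 : Real.exp (-(2 * a) * Real.cosh t)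
        = Real.exp (-(a * Real.exp t)) * Real.exp (-(a * Real.exp (-t))) := by
      rw [← Real.exp_add, Real.cosh_eq]; ring_nf
    simp only
    rw [e1, e2, ← hCC, mul_comm t]
    ring
  have hFi : Integrable F := by
    have := (integrableOn_image_iff_integrableOn_abs_deriv_smul MeasurableSet.univ hder hinj
      (fun u => hker L k c x u)).1 (by rwa [him])
    simp only [hFe] at this
    rwa [integrableOn_univ] at this
  have hI := integral_image_eq_integral_abs_deriv_smul MeasurableSet.univ hder hinj
      (fun u => hker L k c x u)
  simp only [hFe] at hI
  rw [him, setIntegral_univ] at hI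
  rw [hI, ← intervalIntegral.integral_Iic_add_Ioi (b := 0) hFi.integrableOn hFi.integrableOn]
  have hneg := integral_comp_neg_Ioi 0 F
  rw [neg_zero] at hneg
  rw [← hneg, ← integral_add hFi.comp_neg.integrableOn hFi.integrableOn, besselK,
    mul_assoc 2, ← hC, ← integral_const_mul]
  refine setIntegral_congr_fun measurableSet_Ioi fun t _ => ?_
  simp only [hF, Real.cosh_neg]
  rw [Real.cosh_eq ((L - k) * t), mul_neg]
  ring

lemma fc_ae {L k g : ℝ} (hL : 0 < L) (hk : 0 < k) (hg : 0 < g) :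
    (fun x => fcDensity L k g x) =ᵐ[volume.restrict (Ioi 0)]
      fun x => (Real.Gamma L * Real.Gamma k)⁻¹ * ∫ u in Ioi (0:ℝ), hker L k (k / g) x u := by
  have hc : 0 < k / g := by positivity
  filter_upwards [ae_restrict_mem measurableSet_Ioi, (hker_prod hL hk hc).prod_right_ae]
    with x hx hi
  rw [← hker_bessel hc hx hi, fcDensity, mul_div_right_comm k x g]
  ring

lemma fc_int {L k g : ℝ} (hL : 0 < L) (hk : 0 < k) (hg : 0 < g) :
    IntegrableOn (fcDensity L k g) (Ioi 0) ∧ ∫ x in Ioi (0:ℝ), fcDensity L k g x = 1 := by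
  have hc : 0 < k / g := by positivity
  have h1 := Real.Gamma_pos_of_pos hL
  have h2 := Real.Gamma_pos_of_pos hk
  constructor
  · exact ((hker_prod hL hk hc).integral_prod_left.const_mul _).congr (fc_ae hL hk hg).symm
  · rw [integral_congr_ae (fc_ae hL hk hg), integral_const_mul, hker_total hL hk hc]
    field_simp

lemma fc_mean {L k g : ℝ} (hL : 0 < L) (hk : 0 < k) (hg : 0 < g) :
    IntegrableOn (fun x => x * fcDensity L k g x) (Ioi 0) ∧
      ∫ x in Ioi (0:ℝ), x * fcDensity L k g x = L * g := by
  have hc : 0 < k / g := by positivity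
  have h1 := Real.Gamma_pos_of_pos hL
  have h2 := Real.Gamma_pos_of_pos hk
  have hL1 : 0 < L + 1 := by linarith
  have hk1 : 0 < k + 1 := by linarith
  have hae : (fun x => x * fcDensity L k g x) =ᵐ[volume.restrict (Ioi 0)]
      fun x => ((k / g)⁻¹ * (Real.Gamma L * Real.Gamma k)⁻¹) *
        ∫ u in Ioi (0:ℝ), hker (L + 1) (k + 1) (k / g) x u := by
    filter_upwards [ae_restrict_mem measurableSet_Ioi, fc_ae hL hk hg] with x hx h
    have hx : 0 < x := hx
    rw [h]
    have : ∀ u, hker (L + 1) (k + 1) (k / g) x u = (k / g * x) * hker L k (k / g) x u := by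
      intro u
      unfold hker
      rw [Real.rpow_add_one hc.ne', show k + 1 - 1 = (k - 1) + 1 by ring,
        Real.rpow_add_one hx.ne', show L + 1 - (k + 1) - 1 = L - k - 1 by ring]
      ring
    simp only [this]
    rw [integral_const_mul]
    field_simp
  constructor
  · exact ((hker_prod hL1 hk1 hc).integral_prod_left.const_mul _).congr hae.symm
  · rw [integral_congr_ae hae, integral_const_mul, hker_total hL1 hk1 hc,
      Real.Gamma_add_one hL.ne', Real.Gamma_add_one hk.ne']
    field_simp

lemma lim_aux (a : ℝ) :
    Tendsto (fun D : ℝ => D * (1 - Real.exp (-a / D))) atTop (nhds a) := by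
  have h : HasDerivAt (fun s : ℝ => 1 - Real.exp (-a * s)) a 0 := by
    have := (((hasDerivAt_id (0:ℝ)).const_mul (-a)).exp).const_sub 1
    simpa using this
  have h2 := h.tendsto_slope_zero_right.comp tendsto_inv_atTop_nhdsGT_zero
  refine h2.congr fun D => ?_
  simp [div_eq_mul_inv]

/-- Diversity order of the SINR-based selection scheme: with single-branch outage
`F_out(γ; γ̄_D) = ∫₀^∞ (1 - e^{-(1+x)γ/γ̄_D}) f_{γ_I}(x) dx`, the `N`-branch outage
satisfies `γ̄_D^N F_out(γ)^N → (1 + L γ̄_I)^N γ^N` as `γ̄_D → ∞`, i.e. diversity gain `N`. -/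
theorem sinr_sd_diversity_order (L k γbarI γ : ℝ) (hL : 0 < L) (hk : 0 < k)
    (hI : 0 < γbarI) (hγ : 0 < γ) (N : ℕ) (hN : 1 ≤ N) :
    Tendsto
      (fun γbarD : ℝ =>
        γbarD ^ N *
          (∫ x in Ioi (0:ℝ), (1 - Real.exp (-(1 + x) * γ / γbarD)) * fcDensity L k γbarI x) ^ N)
      atTop (nhds ((1 + L * γbarI) ^ N * γ ^ N)) := by
  have hf := fc_int hL hk hI
  have hm := fc_mean hL hk hI
  have key : Tendsto (fun D : ℝ => ∫ x in Ioi (0:ℝ),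
      D * ((1 - Real.exp (-(1 + x) * γ / D)) * fcDensity L k γbarI x)) atTop
      (nhds (∫ x in Ioi (0:ℝ), (1 + x) * γ * fcDensity L k γbarI x)) := by
    have hsum : IntegrableOn (fun x => (1 + x) * γ * fcDensity L k γbarI x) (Ioi 0) :=
      ((hf.1.add hm.1).const_mul γ).congr (Eventually.of_forall fun x => by
        simp only [Pi.add_apply]; ring)
    refine tendsto_integral_filter_of_dominated_convergence
      (fun x => ‖(1 + x) * γ * fcDensity L k γbarI x‖) ?_ ?_ hsum.norm ?_
    · refine Eventually.of_forall fun D => ?_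
      refine AEStronglyMeasurable.const_mul (AEStronglyMeasurable.mul ?_
        hf.1.aestronglyMeasurable) D
      exact Measurable.aestronglyMeasurable (by fun_prop)
    · filter_upwards [eventually_gt_atTop 0] with D hD
      filter_upwards [ae_restrict_mem measurableSet_Ioi] with x hx
      have hx : 0 < x := hx
      rw [← mul_assoc, norm_mul, norm_mul _ (fcDensity L k γbarI x)]
      refine mul_le_mul_of_nonneg_right ?_ (norm_nonneg _)
      have e : -(1 + x) * γ / D = -((1 + x) * γ / D) := by ring
      have hpos : 0 ≤ (1 + x) * γ / D := by positivity
      have h1 : Real.exp (-(1 + x) * γ / D) ≤ 1 := by rw [e]; simpa using hpos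
      have h2 := Real.add_one_le_exp (-(1 + x) * γ / D)
      rw [Real.norm_of_nonneg (mul_nonneg hD.le (by linarith)),
        Real.norm_of_nonneg (by positivity)]
      calc D * (1 - Real.exp (-(1 + x) * γ / D)) ≤ D * ((1 + x) * γ / D) := by
            refine mul_le_mul_of_nonneg_left ?_ hD.le
            linarith
        _ = (1 + x) * γ := by field_simp
    · refine Eventually.of_forall fun x => ?_
      have := (lim_aux ((1 + x) * γ)).mul_const (fcDensity L k γbarI x)
      refine this.congr fun D => ?_
      rw [mul_assoc, neg_mul]
  have hval : ∫ x in Ioi (0:ℝ), (1 + x) * γ * fcDensity L k γbarI x = (1 + L * γbarI) * γ := by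
    have : ∀ x, (1 + x) * γ * fcDensity L k γbarI x
        = γ * (fcDensity L k γbarI x + x * fcDensity L k γbarI x) := fun x => by ring
    simp only [this]
    rw [integral_const_mul, integral_add hf.1 hm.1, hf.2, hm.2]
    ring
  rw [hval] at key
  simp only [integral_const_mul] at key
  have := key.pow N
  simpa only [mul_pow] using this
end
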